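/- Let λ ≠ λ′ be positive reals and let SS_{λ,λ′}(B_max) be the non-Euclidean stress-sheer matrix of the fully doubly braced m×n grid, with rows indexed by the edges of K²_{m,n}. Then the maximal linearly independent sets of rows of SS_{λ,λ′}(B_max) are precisely those corresponding to edge sets of spanning independent cycle-rooted forests in K²_{m,n}; in particular each such set has m+n elements. -/

import Mathlib

open Asymptotics

abbrev V2 : Type := ℝ × ℝ

/-- The standard dot product on `ℝ × ℝ`. -/
def dot (v w : V2) : ℝ := v.1 * w.1 + v.2 * w.2

/-- The Euclidean norm on `ℝ × ℝ`. -/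
noncomputable def eucNorm (v : V2) : ℝ := Real.sqrt (v.1 ^ 2 + v.2 ^ 2)

/-- Rotation by `π/2`. -/
def rot90 (v : V2) : V2 := (-v.2, v.1)

/-- A bar-joint framework in the plane: a placement of joints and a set of bars. -/
structure Framework (J : Type) where
  pos : J → V2
  bars : Set (J × J)

/-- A Euclidean infinitesimal flex. -/
def IsEucFlex {J : Type} (F : Framework J) (u : J → V2) : Prop :=
  ∀ e ∈ F.bars, dot (u e.1 - u e.2) (F.pos e.1 - F.pos e.2) = 0

/-- A Euclidean rigid motion flex: `u i = c + θ • J (p i)`. -/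
def IsRigidMotionFlex {J : Type} (F : Framework J) (u : J → V2) : Prop :=
  ∃ (c : V2) (θ : ℝ), ∀ i, u i = c + θ • rot90 (F.pos i)

/-- Euclidean infinitesimal rigidity. -/
def EucRigid {J : Type} (F : Framework J) : Prop :=
  ∀ u, IsEucFlex F u → IsRigidMotionFlex F u

/-- An infinitesimal flex with respect to a general norm `ν`:
`ν (p i + t u i - (p j + t u j)) - ν (p i - p j) = o(t)` as `t → 0+`, for each bar. -/
def IsFlex (ν : V2 → ℝ) {J : Type} (F : Framework J) (u : J → V2) : Prop :=
  ∀ e ∈ F.bars,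
    (fun t : ℝ =>
        ν (F.pos e.1 + t • u e.1 - (F.pos e.2 + t • u e.2)) - ν (F.pos e.1 - F.pos e.2))
      =o[nhdsWithin 0 (Set.Ioi 0)] (id : ℝ → ℝ)

/-- Infinitesimal rigidity for a (non-Euclidean) norm: every flex is a translation,
i.e. a constant velocity field. -/
def NormRigid (ν : V2 → ℝ) {J : Type} (F : Framework J) : Prop :=
  ∀ u, IsFlex ν F u → ∀ i j, u i = u j

/-- `ν` is a norm on `ℝ²`. -/
def IsNormFn (ν : V2 → ℝ) : Prop :=
  (∀ v, ν v = 0 ↔ v = 0) ∧ (∀ (c : ℝ) (v : V2), ν (c • v) = |c| * ν v) ∧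
    ∀ v w : V2, ν (v + w) ≤ ν v + ν w

/-- `ν` is differentiable (away from the origin). -/
def SmoothNorm (ν : V2 → ℝ) : Prop := ∀ v : V2, v ≠ 0 → DifferentiableAt ℝ ν v

/-- `ν` is strictly convex. -/
def StrictlyConvexNorm (ν : V2 → ℝ) : Prop :=
  ∀ v w : V2, ν v = 1 → ν w = 1 → v ≠ w → ν ((1 / 2 : ℝ) • (v + w)) < 1

/-- `ν` is not a scalar multiple of the Euclidean norm. -/
def NonEuclidean (ν : V2 → ℝ) : Prop := ¬∃ c : ℝ, ∀ v, ν v = c * eucNorm v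

/-- The point of the unit sphere of `ν` in the direction `θ`. -/
noncomputable def sphPt (ν : V2 → ℝ) (θ : ℝ) : V2 :=
  (ν (Real.cos θ, Real.sin θ))⁻¹ • ((Real.cos θ, Real.sin θ) : V2)

/-- `w` is tangent to the unit sphere of `ν` at the point `q`. -/
def IsTangentAt (ν : V2 → ℝ) (q w : V2) : Prop := fderiv ℝ ν q w = 0

/-- The positively oriented unit tangent vector to the unit sphere of `ν`
at its point in the direction `θ`. -/
def IsPosUnitTangent (ν : V2 → ℝ) (θ : ℝ) (w : V2) : Prop :=
  ν w = 1 ∧ IsTangentAt ν (sphPt ν θ) w ∧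
    0 < (sphPt ν θ).1 * w.2 - (sphPt ν θ).2 * w.1

/-- Rotation of the plane by the angle `α`. -/
noncomputable def rotv (α : ℝ) (v : V2) : V2 :=
  (v.1 * Real.cos α - v.2 * Real.sin α, v.1 * Real.sin α + v.2 * Real.cos α)

/-- The joints of the `m × n` grid. -/
abbrev Joint (m n : ℕ) := Fin (m + 1) × Fin (n + 1)

/-- A brace: a square `(j,k)` together with a colour (`true` = blue diagonal
from `(j,k)` to `(j+1,k+1)`, `false` = red diagonal from `(j+1,k)` to `(j,k+1)`). -/
abbrev Brace (m n : ℕ) := Fin m × Fin n × Bool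

/-- The bars of the unbraced `m × n` grid: unit horizontal and vertical segments. -/
def gridBars (m n : ℕ) : Set (Joint m n × Joint m n) :=
  {e | ((e.1.1 : ℕ) + 1 = (e.2.1 : ℕ) ∧ e.1.2 = e.2.2) ∨
      (e.1.1 = e.2.1 ∧ (e.1.2 : ℕ) + 1 = (e.2.2 : ℕ))}

/-- The bar corresponding to a brace. -/
def braceBar {m n : ℕ} (b : Brace m n) : Joint m n × Joint m n :=
  if b.2.2 then ((b.1.castSucc, b.2.1.castSucc), (b.1.succ, b.2.1.succ))
  else ((b.1.succ, b.2.1.castSucc), (b.1.castSucc, b.2.1.succ))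

/-- The axis-aligned braced `m × n` grid framework `G(B)`. -/
noncomputable def plainBracedGrid (m n : ℕ) (B : Set (Brace m n)) : Framework (Joint m n) where
  pos := fun v => ((v.1 : ℝ), (v.2 : ℝ))
  bars := gridBars m n ∪ braceBar '' B

/-- The braced `m × n` grid framework `G(B)` of inclination `α`. -/
noncomputable def bracedGrid (m n : ℕ) (α : ℝ) (B : Set (Brace m n)) : Framework (Joint m n) where
  pos := fun v => rotv α ((v.1 : ℝ), (v.2 : ℝ))
  bars := gridBars m n ∪ braceBar '' B

/-- The braced `m × n` grid of `a × b` rectangles with inclination `α`. -/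
noncomputable def bracedRectGrid (m n : ℕ) (a b α : ℝ) (B : Set (Brace m n)) :
    Framework (Joint m n) where
  pos := fun v => rotv α ((v.1 : ℝ) * a, (v.2 : ℝ) * b)
  bars := gridBars m n ∪ braceBar '' B

/-- The unbraced axis-aligned `m × n` grid framework. -/
noncomputable def unbracedGrid (m n : ℕ) : Framework (Joint m n) where
  pos := fun v => ((v.1 : ℝ), (v.2 : ℝ))
  bars := gridBars m n

/-- The lines of the grid: `Sum.inl k` is the horizontal line at height `k`,
`Sum.inr j` is the vertical line at abscissa `j`. -/
abbrev LineIdx (m n : ℕ) := Fin (n + 1) ⊕ Fin (m + 1)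

/-- The basis velocity field `u_l` supported on the joints of the line `l`. -/
def lineField (m n : ℕ) (l : LineIdx m n) : Joint m n → V2 := fun v =>
  match l with
  | Sum.inl k => if v.2 = k then (1, 0) else (0, 0)
  | Sum.inr j => if v.1 = j then (0, 1) else (0, 0)

/-- The ribbons of the grid: `Sum.inl j` is the vertical ribbon `[j,j+1] × [0,n]`,
`Sum.inr k` is the horizontal ribbon `[0,m] × [k,k+1]`. -/
abbrev RibbonIdx (m n : ℕ) := Fin m ⊕ Fin n

/-- The sheer map on coefficient fields: `σ(u)(ρ) = d_{l₁} - d_{l₂}` for the boundary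
lines `l₁` (right-hand, resp. lower) and `l₂` of the ribbon `ρ`. -/
def sheer {m n : ℕ} (d : LineIdx m n → ℝ) : RibbonIdx m n → ℝ := fun ρ =>
  match ρ with
  | Sum.inl j => d (Sum.inr j.succ) - d (Sum.inr j.castSucc)
  | Sum.inr k => d (Sum.inl k.castSucc) - d (Sum.inl k.succ)

/-- The row of the Euclidean stress-sheer matrix indexed by a brace. -/
def eucSSRow {m n : ℕ} (b : Brace m n) : RibbonIdx m n → ℝ := fun ρ =>
  match ρ with
  | Sum.inl j => if j = b.1 then 1 else 0
  | Sum.inr k => if k = b.2.1 then -1 else 0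

/-- The row of the Euclidean stress-sheer matrix of the fully braced grid
indexed by a square. -/
def eucSqRow {m n : ℕ} (s : Fin m × Fin n) : RibbonIdx m n → ℝ := fun ρ =>
  match ρ with
  | Sum.inl j => if j = s.1 then 1 else 0
  | Sum.inr k => if k = s.2 then -1 else 0

/-- The row of the non-Euclidean stress-sheer matrix `SS_{λ,λ'}` indexed by a brace:
`+1` at the vertical ribbon, `-λ` (blue) or `-λ'` (red) at the horizontal ribbon. -/
def neRow {m n : ℕ} (lam lam' : ℝ) (b : Brace m n) : RibbonIdx m n → ℝ := fun ρ =>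
  match ρ with
  | Sum.inl j => if j = b.1 then 1 else 0
  | Sum.inr k => if k = b.2.1 then (if b.2.2 then -lam else -lam') else 0

/-- Adjacency of rows (`Sum.inl`) and columns (`Sum.inr`) in the (bicoloured) braces
graph with edge set `B`. -/
def bracesAdj {m n : ℕ} (B : Set (Brace m n)) (v w : Fin m ⊕ Fin n) : Prop :=
  ∃ e ∈ B, (v = Sum.inl e.1 ∧ w = Sum.inr e.2.1) ∨ (w = Sum.inl e.1 ∧ v = Sum.inr e.2.1)

/-- A (bicoloured) cycle of length `2(k+1)` in `K²_{m,n}`: rows `row 0, …, row k`,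
columns `col 0, …, col k`, odd edges `e_{2i+1} = (row i, col i, c1 i)` and even edges
`e_{2i+2} = (row (i+1), col i, c2 i)` (cyclically); all `2(k+1)` edges are distinct. -/
structure BCycle (m n : ℕ) where
  k : ℕ
  row : Fin (k + 1) → Fin m
  col : Fin (k + 1) → Fin n
  c1 : Fin (k + 1) → Bool
  c2 : Fin (k + 1) → Bool
  rowInj : Function.Injective row
  colInj : Function.Injective col
  nontriv : k = 0 → c1 ≠ c2

/-- The odd edges of a bicoloured cycle. -/
def BCycle.edge1 {m n : ℕ} (C : BCycle m n) (i : Fin (C.k + 1)) : Brace m n :=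
  (C.row i, C.col i, C.c1 i)

/-- The even edges of a bicoloured cycle. -/
def BCycle.edge2 {m n : ℕ} (C : BCycle m n) (i : Fin (C.k + 1)) : Brace m n :=
  (C.row (i + 1), C.col i, C.c2 i)

/-- The edge set of a bicoloured cycle. -/
def BCycle.edges {m n : ℕ} (C : BCycle m n) : Set (Brace m n) :=
  Set.range C.edge1 ∪ Set.range C.edge2

/-- Dependent colouring: the number of blue edges in odd position equals the number
of blue edges in even position. -/
def BCycle.DepColouring {m n : ℕ} (C : BCycle m n) : Prop :=
  (Finset.univ.filter fun i => C.c1 i = true).card =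
    (Finset.univ.filter fun i => C.c2 i = true).card

/-- Linear independence of the set of rows of `SS_{λ,λ'}` indexed by `S`. -/
def RowsIndep (m n : ℕ) (lam lam' : ℝ) (S : Set (Brace m n)) : Prop :=
  LinearIndependent ℝ fun e : S => neRow lam lam' (e : Brace m n)

/-- `S` is a circuit of the row matroid of `SS_{λ,λ'}`: a minimal dependent set of rows. -/
def IsCircuit (m n : ℕ) (lam lam' : ℝ) (S : Set (Brace m n)) : Prop :=
  ¬RowsIndep m n lam lam' S ∧ ∀ S' ⊂ S, RowsIndep m n lam lam' S'

/-- `S ⊆ K²_{m,n}` is a spanning independent cycle-rooted forest: every connected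
component (of the multigraph with edge set `S` on the `m + n` vertices) has as many
edges as vertices, i.e. is a cycle-rooted tree (so in particular `S` is spanning),
and every cycle of edges in `S` has an independent colouring. -/
def IsSpanningICRF (m n : ℕ) (S : Set (Brace m n)) : Prop :=
  (∀ v : Fin m ⊕ Fin n,
      {e ∈ S | Relation.ReflTransGen (bracesAdj S) v (Sum.inl e.1)}.ncard =
        {w | Relation.ReflTransGen (bracesAdj S) v w}.ncard) ∧
  ∀ C : BCycle m n, C.edges ⊆ S → ¬C.DepColouring

/-- The `p`-norm on the plane. -/
noncomputable def pNorm (p : ℝ) : V2 → ℝ := fun v => (|v.1| ^ p + |v.2| ^ p) ^ (1 / p)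

/-- The sup norm on the plane. -/
noncomputable def supNorm : V2 → ℝ := fun v => max |v.1| |v.2|

section RowMatroid

variable {m n : ℕ}

/-- The weight of a colour in the stress-sheer matrix. -/
def colourWeight (lam lam' : ℝ) (c : Bool) : ℝ := if c then lam else lam'

lemma colourWeight_ne_zero {lam lam' : ℝ} (h : 0 < lam) (h' : 0 < lam') (c : Bool) :
    colourWeight lam lam' c ≠ 0 := by
  cases c <;> simp [colourWeight, h.ne', h'.ne']

lemma neRow_inl (lam lam' : ℝ) (e : Brace m n) (j : Fin m) :
    neRow lam lam' e (Sum.inl j) = if j = e.1 then 1 else 0 := rfl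

lemma neRow_inr (lam lam' : ℝ) (e : Brace m n) (k : Fin n) :
    neRow lam lam' e (Sum.inr k) =
      if k = e.2.1 then -colourWeight lam lam' e.2.2 else 0 := by
  simp only [neRow, colourWeight]
  split_ifs <;> rfl

lemma sum_neRow_mul (lam lam' : ℝ) (e : Brace m n) (x : RibbonIdx m n → ℝ) :
    ∑ v, neRow lam lam' e v * x v =
      x (Sum.inl e.1) - colourWeight lam lam' e.2.2 * x (Sum.inr e.2.1) := by
  simp [Fintype.sum_sum_type, neRow_inl, neRow_inr, sub_eq_add_neg]

lemma prod_colourWeight (lam lam' : ℝ) {k : ℕ} (c : Fin k → Bool) :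
    ∏ i, colourWeight lam lam' (c i) =
      lam ^ (Finset.univ.filter fun i => c i = true).card *
        lam' ^ (k - (Finset.univ.filter fun i => c i = true).card) := by
  have h := Finset.card_filter_add_card_filter_not (s := (Finset.univ : Finset (Fin k)))
    (fun i => c i = true)
  simp only [colourWeight, Finset.prod_ite, Finset.prod_const]
  congr 2
  simp only [Finset.card_univ, Fintype.card_fin] at h
  omega

/-- The weights of the odd and even edges of a cycle have equal products exactly when
the colouring is dependent. -/
lemma BCycle.prod_colourWeight_eq_iff {lam lam' : ℝ} (hlam : 0 < lam) (hlam' : 0 < lam')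
    (hne : lam ≠ lam') (C : BCycle m n) :
    ∏ i, colourWeight lam lam' (C.c1 i) = ∏ i, colourWeight lam lam' (C.c2 i) ↔
      C.DepColouring := by
  have key : ∀ N p : ℕ, p ≤ N → lam ^ p * lam' ^ (N - p) = lam' ^ N * (lam / lam') ^ p := by
    intro N p hp
    rw [div_pow, ← mul_div_assoc, eq_div_iff (pow_ne_zero _ hlam'.ne'), mul_assoc, ← pow_add,
      Nat.sub_add_cancel hp, mul_comm]
  have hle : ∀ c : Fin (C.k + 1) → Bool,
      (Finset.univ.filter fun i => c i = true).card ≤ C.k + 1 :=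
    fun c => (Finset.card_filter_le _ _).trans_eq (by simp)
  rw [prod_colourWeight, prod_colourWeight, key _ _ (hle C.c1), key _ _ (hle C.c2),
    mul_right_inj' (pow_ne_zero _ hlam'.ne'), BCycle.DepColouring]
  refine (pow_right_injective₀ (div_pos hlam hlam') ?_).eq_iff
  rwa [Ne, div_eq_one_iff_eq hlam'.ne']

/-- A cyclic sequence with product one is the sequence of successive ratios of a nonzero
function. -/
lemma exists_cyclic_ratio {k : ℕ} (q : Fin (k + 1) → ℝ) (hprod : ∏ i, q i = 1) :
    ∃ a : Fin (k + 1) → ℝ, a 0 ≠ 0 ∧ ∀ i, a (i + 1) = a i * q i := by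
  refine ⟨fun i => Fin.partialProd q i.castSucc, by simp, fun i => ?_⟩
  simp only
  rw [← Fin.partialProd_succ]
  induction i using Fin.lastCases with
  | last =>
    rw [Fin.last_add_one, Fin.castSucc_zero, Fin.partialProd_zero, Fin.succ_last]
    rw [← hprod, Fin.partialProd, ← List.prod_ofFn, List.take_of_length_le (by simp)]
  | cast i =>
    congr 1
    ext
    simp

lemma BCycle.edge1_ne_edge2 (C : BCycle m n) (i j : Fin (C.k + 1)) : C.edge1 i ≠ C.edge2 j := by
  intro h
  simp only [BCycle.edge1, BCycle.edge2, Prod.mk.injEq] at h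
  obtain ⟨h1, h2, h3⟩ := h
  obtain rfl := C.colInj h2
  have h4 := C.rowInj h1
  have hk : C.k = 0 := by
    by_contra hk
    simp [hk] at h4
  refine C.nontriv hk (funext fun j => ?_)
  have : Subsingleton (Fin (C.k + 1)) := Fin.subsingleton_iff_le_one.2 (by omega)
  rwa [Subsingleton.elim j i]

lemma BCycle.not_depColouring_of_rowsIndep {lam lam' : ℝ} (hlam : 0 < lam) (hlam' : 0 < lam')
    (hne : lam ≠ lam') {S : Set (Brace m n)} (hS : RowsIndep m n lam lam' S)
    (C : BCycle m n) (hC : C.edges ⊆ S) : ¬C.DepColouring := by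
  intro hdep
  have hw := colourWeight_ne_zero hlam hlam'
  obtain ⟨a, ha0, ha⟩ := exists_cyclic_ratio
    (fun i => colourWeight lam lam' (C.c1 i) / colourWeight lam lam' (C.c2 i))
    (by
      rw [Finset.prod_div_distrib, (C.prod_colourWeight_eq_iff hlam hlam' hne).2 hdep,
        div_self (Finset.prod_ne_zero_iff.2 fun i _ => hw _)])
  let g : Fin (C.k + 1) ⊕ Fin (C.k + 1) → S := Sum.elim
    (fun i => ⟨C.edge1 i, hC (Or.inl ⟨i, rfl⟩)⟩) (fun i => ⟨C.edge2 i, hC (Or.inr ⟨i, rfl⟩)⟩)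
  have hg : Function.Injective g := by
    rintro (i | i) (j | j) h <;> simp only [g, Sum.elim_inl, Sum.elim_inr, Subtype.mk.injEq] at h
    · exact congrArg _ (C.colInj (congrArg (fun e => e.2.1) h))
    · exact absurd h (C.edge1_ne_edge2 _ _)
    · exact absurd h.symm (C.edge1_ne_edge2 _ _)
    · exact congrArg _ (C.colInj (congrArg (fun e => e.2.1) h))
  have hind := Fintype.linearIndependent_iff.1 (LinearIndependent.comp hS g hg)
    (Sum.elim a fun i => -a (i + 1)) (by
      ext v
      simp only [Fintype.sum_sum_type, Sum.elim_inl, Sum.elim_inr, Function.comp, g,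
        Finset.sum_apply, Pi.smul_apply, smul_eq_mul, Pi.zero_apply]
      rcases v with j | k
      · simp only [neRow_inl, BCycle.edge1, BCycle.edge2, neg_mul, Finset.sum_neg_distrib]
        rw [← Equiv.sum_comp (Equiv.addRight (1 : Fin (C.k + 1)))
          (fun i => a i * if j = C.row i then (1 : ℝ) else 0)]
        exact add_neg_cancel _
      · rw [← Finset.sum_add_distrib]
        refine Finset.sum_eq_zero fun i _ => ?_
        simp only [neRow_inr, BCycle.edge1, BCycle.edge2]
        split_ifs
        · rw [ha]
          field_simp [hw (C.c2 i)]
          ring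
        · simp) (Sum.inl 0)
  exact ha0 hind

/-- Independent rows supported on a set of ribbons are at most as many as these ribbons. -/
lemma ncard_le_of_rowsIndep {lam lam' : ℝ} {T : Set (Brace m n)}
    (hT : RowsIndep m n lam lam' T) (W : Set (Fin m ⊕ Fin n))
    (hW : ∀ e ∈ T, Sum.inl e.1 ∈ W ∧ Sum.inr e.2.1 ∈ W) : T.ncard ≤ W.ncard := by
  classical
  have h : LinearIndependent ℝ fun (e : T) (w : W) => neRow lam lam' (e : Brace m n) w := by
    rw [Fintype.linearIndependent_iff]
    intro c hc
    refine Fintype.linearIndependent_iff.1 hT c ?_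
    ext v
    by_cases hv : v ∈ W
    · simpa using congrFun hc ⟨v, hv⟩
    · simp only [Finset.sum_apply, Pi.smul_apply, smul_eq_mul, Pi.zero_apply]
      refine Finset.sum_eq_zero fun e _ => mul_eq_zero_of_right _ ?_
      rcases v with j | k
      · rw [neRow_inl, if_neg]
        rintro rfl
        exact hv (hW e e.2).1
      · rw [neRow_inr, if_neg]
        rintro rfl
        exact hv (hW e e.2).2
  simpa [Set.ncard_eq_toFinset_card', Set.toFinset_card] using h.fintype_card_le_finrank

/-- A family of rows not spanning the whole space is annihilated by a nonzero vector. -/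
lemma exists_annihilator {lam lam' : ℝ} {S : Set (Brace m n)}
    (h : Submodule.span ℝ (neRow lam lam' '' S) ≠ ⊤) :
    ∃ x : RibbonIdx m n → ℝ, x ≠ 0 ∧
      (∀ y ∈ Submodule.span ℝ (neRow lam lam' '' S), ∑ v, y v * x v = 0) := by
  obtain ⟨f, hf0, hf⟩ := Submodule.exists_le_ker_of_lt_top _ h.lt_top
  have hfx : ∀ y, f y = ∑ v, y v * f (Pi.single v 1) := by
    intro y
    conv_lhs => rw [pi_eq_sum_univ' y]
    simp [map_sum]
  refine ⟨fun v => f (Pi.single v 1), fun h0 => hf0 (LinearMap.ext fun y => ?_), fun y hy => ?_⟩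
  · rw [hfx]
    simp [congrFun h0]
  · rw [← hfx]
    exact hf hy

/-- A maximal independent set of rows is a basis of the whole space. -/
lemma ncard_eq_of_maximal_rowsIndep (hm : 1 ≤ m) (hn : 1 ≤ n) {lam lam' : ℝ}
    (hne : lam ≠ lam') {S : Set (Brace m n)} (hS : RowsIndep m n lam lam' S)
    (hmax : ∀ S' : Set (Brace m n), S ⊂ S' → ¬RowsIndep m n lam lam' S') :
    S.ncard = m + n := by
  classical
  have hspan : Submodule.span ℝ (neRow lam lam' '' S) = ⊤ := by
    by_contra h
    obtain ⟨x, hx0, hx⟩ := exists_annihilator h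
    have hall : ∀ e : Brace m n, x (Sum.inl e.1) - colourWeight lam lam' e.2.2 * x (Sum.inr e.2.1) = 0 := by
      intro e
      rw [← sum_neRow_mul]
      refine hx _ ?_
      by_contra he
      refine hmax (insert e S) (Set.ssubset_insert fun heS => he ?_) (LinearIndepOn.insert hS he)
      exact Submodule.subset_span ⟨e, heS, rfl⟩
    have hr : ∀ (j : Fin m) (k : Fin n), x (Sum.inl j) = 0 ∧ x (Sum.inr k) = 0 := by
      intro j k
      have h1 := hall (j, k, true)
      have h2 := hall (j, k, false)
      simp only [colourWeight, if_true, Bool.false_eq_true, if_false] at h1 h2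
      have h3 : (lam - lam') * x (Sum.inr k) = 0 := by linear_combination h2 - h1
      have h4 : x (Sum.inr k) = 0 := (mul_eq_zero.1 h3).resolve_left (sub_ne_zero.2 hne)
      exact ⟨by rw [h4] at h1; linarith, h4⟩
    refine hx0 (funext ?_)
    rintro (j | k)
    · exact (hr j ⟨0, hn⟩).1
    · exact (hr ⟨0, hm⟩ k).2
  have h := finrank_span_eq_card hS
  rw [show Set.range (fun e : S => neRow lam lam' (e : Brace m n)) = neRow lam lam' '' S by
    rw [Set.image_eq_range], hspan, finrank_top] at h
  simp only [Module.finrank_fintype_fun_eq_card, Fintype.card_sum, Fintype.card_fin] at h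
  rw [Set.ncard_eq_toFinset_card', Set.toFinset_card, h]

instance (S : Set (Brace m n)) : Std.Symm (bracesAdj S) where
  symm _ _ := fun ⟨e, he, h⟩ => ⟨e, he, h.symm⟩

lemma bracesAdj_of_mem {S : Set (Brace m n)} {e : Brace m n} (he : e ∈ S) :
    bracesAdj S (Sum.inl e.1) (Sum.inr e.2.1) := ⟨e, he, Or.inl ⟨rfl, rfl⟩⟩

/-- Connectedness in the braces graph. -/
def bracesSetoid (S : Set (Brace m n)) : Setoid (Fin m ⊕ Fin n) where
  r := Relation.ReflTransGen (bracesAdj S)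
  iseqv := ⟨fun _ => .refl,
    fun h => symm h, fun h => h.trans⟩

/-- Every component of a maximal independent set of rows has as many edges as vertices. -/
lemma component_ncard_eq {lam lam' : ℝ} {S : Set (Brace m n)} (hS : RowsIndep m n lam lam' S)
    (hcard : S.ncard = m + n) (v : Fin m ⊕ Fin n) :
    {e ∈ S | Relation.ReflTransGen (bracesAdj S) v (Sum.inl e.1)}.ncard =
      {w | Relation.ReflTransGen (bracesAdj S) v w}.ncard := by
  set E := {e ∈ S | Relation.ReflTransGen (bracesAdj S) v (Sum.inl e.1)}
  set W := {w | Relation.ReflTransGen (bracesAdj S) v w}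
  have hES : E ⊆ S := fun e he => he.1
  have h1 : E.ncard ≤ W.ncard := ncard_le_of_rowsIndep (LinearIndepOn.mono hS hES) W
    fun e he => ⟨he.2, he.2.tail (bracesAdj_of_mem he.1)⟩
  have h2 : (S \ E).ncard ≤ Wᶜ.ncard :=
    ncard_le_of_rowsIndep (LinearIndepOn.mono hS Set.sdiff_subset) Wᶜ fun e he =>
      ⟨fun h => he.2 ⟨he.1, h⟩,
        fun h => he.2 ⟨he.1, h.tail (symm (bracesAdj_of_mem he.1))⟩⟩
  have h3 := Set.ncard_sdiff_add_ncard_of_subset hES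
  have h4 := Set.ncard_add_ncard_compl W
  simp only [Nat.card_eq_fintype_card, Fintype.card_sum, Fintype.card_fin] at h4
  omega

/-- If every component has as many edges as vertices, so does the whole graph. -/
lemma ncard_eq_of_component_ncard_eq {S : Set (Brace m n)}
    (h : ∀ v : Fin m ⊕ Fin n,
      {e ∈ S | Relation.ReflTransGen (bracesAdj S) v (Sum.inl e.1)}.ncard =
        {w | Relation.ReflTransGen (bracesAdj S) v w}.ncard) : S.ncard = m + n := by
  classical
  have hV := Finset.card_eq_sum_card_fiberwise (s := (Finset.univ : Finset (Fin m ⊕ Fin n)))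
    (t := Finset.univ) (f := fun w => (Quotient.mk (bracesSetoid S) w)) (by simp)
  have hE := Finset.card_eq_sum_card_fiberwise (s := S.toFinset) (t := Finset.univ)
    (f := fun e => (Quotient.mk (bracesSetoid S) (Sum.inl e.1))) (by simp)
  rw [Set.ncard_eq_toFinset_card', hE]
  trans (Finset.univ : Finset (Fin m ⊕ Fin n)).card
  · rw [hV]
    refine Finset.sum_congr rfl fun K _ => ?_
    induction K using Quotient.inductionOn with | h v => ?_
    have hv := h v
    rw [Set.ncard_eq_toFinset_card', Set.ncard_eq_toFinset_card'] at hv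
    convert hv using 2
    · ext e
      simp only [Finset.mem_filter, Set.mem_toFinset, Set.mem_ofPred_eq]
      refine and_congr_right fun _ => ?_
      rw [eq_comm, Quotient.eq]
      rfl
    · ext w
      simp only [Finset.mem_filter, Set.mem_toFinset, Set.mem_ofPred_eq, Finset.mem_univ, true_and]
      rw [eq_comm, Quotient.eq]
      rfl
  · simp

/-- A nonempty edge set in which every edge shares its row and its column with another
edge contains a cycle. -/
lemma exists_bCycle_of_forall_exists_ne {T : Set (Brace m n)} (hT : T.Nonempty)
    (hrow : ∀ e ∈ T, ∃ f ∈ T, f ≠ e ∧ f.1 = e.1)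
    (hcol : ∀ e ∈ T, ∃ f ∈ T, f ≠ e ∧ f.2.1 = e.2.1) : ∃ C : BCycle m n, C.edges ⊆ T := by
  classical
  choose! ρ hρT hρne hρ using hrow
  choose! κ hκT hκne hκ using hcol
  obtain ⟨e₀, he₀⟩ := hT
  let E : ℕ → Brace m n := fun t => (fun e => ρ (κ e))^[t] e₀
  let F : ℕ → Brace m n := fun t => κ (E t)
  have hEs : ∀ t, E (t + 1) = ρ (F t) := fun t => Function.iterate_succ_apply' _ _ _
  have hET : ∀ t, E t ∈ T := by
    intro t
    induction t with
    | zero => exact he₀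
    | succ t ih => rw [hEs]; exact hρT _ (hκT _ ih)
  have hFT : ∀ t, F t ∈ T := fun t => hκT _ (hET t)
  have hFE : ∀ t, F t ≠ E t := fun t => hκne _ (hET t)
  have hEF : ∀ t, E (t + 1) ≠ F t := fun t => by rw [hEs]; exact hρne _ (hFT t)
  have hcolF : ∀ t, (F t).2.1 = (E t).2.1 := fun t => hκ _ (hET t)
  have hrowF : ∀ t, (F t).1 = (E (t + 1)).1 := fun t => by rw [hEs]; exact (hρ _ (hFT t)).symm
  have hex : ∃ L, ∃ i, (E i).1 = (E (i + L + 1)).1 ∨ (E i).2.1 = (E (i + L + 1)).2.1 := by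
    obtain ⟨i, j, hij, h⟩ := Finite.exists_ne_map_eq_of_infinite (fun t => (E t).1)
    rcases lt_or_gt_of_ne hij with hlt | hlt
    · exact ⟨j - i - 1, i, Or.inl (by rw [show i + (j - i - 1) + 1 = j by omega]; exact h)⟩
    · exact ⟨i - j - 1, j, Or.inl (by rw [show j + (i - j - 1) + 1 = i by omega]; exact h.symm)⟩
  obtain ⟨i, hi⟩ := Nat.find_spec hex
  have hmin := fun l (hl : l < Nat.find hex) => not_exists.1 (Nat.find_min hex hl)
  set k := Nat.find hex
  have hrowInj : ∀ s, Function.Injective fun t : Fin (k + 1) => (E (s + t)).1 := by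
    refine fun s => Function.Injective.of_lt_imp_ne fun a b hab h => ?_
    refine hmin (b - a - 1) (by omega) (s + a) (Or.inl ?_)
    rw [show s + a + (b - a - 1 : ℕ) + 1 = s + b by omega]
    exact h
  have hcolInj : ∀ s, Function.Injective fun t : Fin (k + 1) => (E (s + t)).2.1 := by
    refine fun s => Function.Injective.of_lt_imp_ne fun a b hab h => ?_
    refine hmin (b - a - 1) (by omega) (s + a) (Or.inr ?_)
    rw [show s + a + (b - a - 1 : ℕ) + 1 = s + b by omega]
    exact h
  have hmk : ∀ (s : ℕ) (G : Fin (k + 1) → Brace m n), (∀ t, G t ∈ T) →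
      (∀ t, (G t).1 = (E (s + (t + 1 : Fin (k + 1)))).1) →
      (∀ t, (G t).2.1 = (E (s + t)).2.1) → (k = 0 → G 0 ≠ E s) →
      ∃ C : BCycle m n, C.edges ⊆ T := by
    intro s G hG hGr hGc hG0
    refine ⟨⟨k, fun t => (E (s + t)).1, fun t => (E (s + t)).2.1, fun t => (E (s + t)).2.2,
      fun t => (G t).2.2, hrowInj s, hcolInj s, fun hk h => hG0 hk ?_⟩, ?_⟩
    · have h0 : (0 + 1 : Fin (k + 1)) = 0 := by
        have : Subsingleton (Fin (k + 1)) := Fin.subsingleton_iff_le_one.2 (by omega)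
        exact Subsingleton.elim _ _
      have h1 := hGr 0
      rw [h0] at h1
      exact Prod.ext h1 (Prod.ext (hGc 0) (congrFun h 0).symm)
    · rintro e (⟨t, rfl⟩ | ⟨t, rfl⟩)
      · exact hET (s + t)
      · convert hG t using 1
        exact Prod.ext (hGr t).symm (Prod.ext (hGc t).symm rfl)
  rcases hi with hi | hi
  · refine hmk i (fun t => F (i + t)) (fun t => hFT _) (fun t => ?_) (fun t => hcolF _)
      (fun _ => hFE i)
    rw [hrowF]
    induction t using Fin.lastCases with
    | last => simp [hi]
    | cast t => simp [add_assoc]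
  · refine hmk (i + 1) (fun t => if t = Fin.last k then F i else F (i + 1 + t))
      (fun t => by split_ifs <;> exact hFT _) (fun t => ?_) (fun t => ?_) (fun hk => ?_)
    · induction t using Fin.lastCases with
      | last => simp [hrowF]
      | cast t => simp [hrowF, add_assoc, (Fin.castSucc_lt_last t).ne]
    · split_ifs with ht
      · subst ht
        rw [hcolF, hi, Fin.val_last]
        congr 3
        omega
      · exact hcolF _
    · rw [if_pos (Fin.ext (by simp [hk]))]
      exact (hEF i).symm

/-- An edge set with at least as many edges as vertices contains a cycle. -/
lemma exists_bCycle_of_ncard_le (T : Set (Brace m n)) (W : Set (Fin m ⊕ Fin n))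
    (hne : W.Nonempty) (hW : ∀ e ∈ T, Sum.inl e.1 ∈ W ∧ Sum.inr e.2.1 ∈ W)
    (hcard : W.ncard ≤ T.ncard) : ∃ C : BCycle m n, C.edges ⊆ T := by
  induction hN : T.ncard generalizing T W with
  | zero =>
    have := (Set.ncard_pos W.toFinite).2 hne
    omega
  | succ N ih =>
    have hrem : ∀ e ∈ T, ∀ v w, v ∈ W → w ∈ W → w ≠ v →
        (∀ f ∈ T, f ≠ e → Sum.inl f.1 ≠ v ∧ Sum.inr f.2.1 ≠ v) →
        ∃ C : BCycle m n, C.edges ⊆ T := by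
      intro e he v w hv hw hwv hf
      have h1 := Set.ncard_sdiff_singleton_of_mem he
      have h2 := Set.ncard_sdiff_singleton_of_mem hv
      obtain ⟨C, hC⟩ := ih (T \ {e}) (W \ {v}) ⟨w, hw, hwv⟩
        (fun f hfT => ⟨⟨(hW f hfT.1).1, (hf f hfT.1 hfT.2).1⟩,
          ⟨(hW f hfT.1).2, (hf f hfT.1 hfT.2).2⟩⟩) (by omega) (by omega)
      exact ⟨C, hC.trans Set.sdiff_subset⟩
    by_contra hC
    refine hC (exists_bCycle_of_forall_exists_ne (Set.nonempty_of_ncard_ne_zero (by omega))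
      (fun e he => ?_) (fun e he => ?_))
    · by_contra! h
      exact hC (hrem e he _ _ (hW e he).1 (hW e he).2 (by simp)
        fun f hf hfe => ⟨by simpa using h f hf hfe, by simp⟩)
    · by_contra! h
      exact hC (hrem e he _ _ (hW e he).2 (hW e he).1 (by simp)
        fun f hf hfe => ⟨by simp, by simpa using h f hf hfe⟩)

/-- The rows of a spanning independent cycle-rooted forest are linearly independent. -/
lemma IsSpanningICRF.rowsIndep {lam lam' : ℝ} (hlam : 0 < lam) (hlam' : 0 < lam')
    (hne : lam ≠ lam') {S : Set (Brace m n)} (hS : IsSpanningICRF m n S) :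
    RowsIndep m n lam lam' S := by
  classical
  have hw := colourWeight_ne_zero hlam hlam'
  have hcard := ncard_eq_of_component_ncard_eq hS.1
  refine linearIndependent_of_top_le_span_of_card_eq_finrank ?_ ?_
  · rw [← Set.image_eq_range, top_le_iff]
    by_contra h
    obtain ⟨x, hx0, hx⟩ := exists_annihilator h
    have hedge : ∀ e ∈ S, x (Sum.inl e.1) = colourWeight lam lam' e.2.2 * x (Sum.inr e.2.1) :=
      fun e he => sub_eq_zero.1 (by
        rw [← sum_neRow_mul]
        exact hx _ (Submodule.subset_span ⟨e, he, rfl⟩))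
    have hzero : ∀ v w, Relation.ReflTransGen (bracesAdj S) v w → x w = 0 → x v = 0 := by
      intro v w h hxw
      induction h using Relation.ReflTransGen.head_induction_on with
      | refl => exact hxw
      | head h _ ih =>
        obtain ⟨e, he, ⟨rfl, rfl⟩ | ⟨rfl, rfl⟩⟩ := h
        · rw [hedge e he, ih, mul_zero]
        · rw [hedge e he] at ih
          exact (mul_eq_zero.1 ih).resolve_left (hw _)
    refine hx0 (funext fun v => ?_)
    obtain ⟨C, hC⟩ := exists_bCycle_of_ncard_le _ _ ⟨v, Relation.ReflTransGen.refl⟩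
      (fun e he => ⟨he.2, he.2.tail (bracesAdj_of_mem he.1)⟩) (hS.1 v).ge
    have h1 : ∀ i, x (Sum.inl (C.row i)) =
        colourWeight lam lam' (C.c1 i) * x (Sum.inr (C.col i)) :=
      fun i => hedge (C.edge1 i) (hC (Or.inl ⟨i, rfl⟩)).1
    have h2 : ∀ i, x (Sum.inl (C.row (i + 1))) =
        colourWeight lam lam' (C.c2 i) * x (Sum.inr (C.col i)) :=
      fun i => hedge (C.edge2 i) (hC (Or.inr ⟨i, rfl⟩)).1
    have h3 := Equiv.prod_comp (Equiv.addRight (1 : Fin (C.k + 1)))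
      (fun i => x (Sum.inl (C.row i)))
    simp only [Equiv.coe_addRight, h2] at h3
    simp only [h1, Finset.prod_mul_distrib] at h3
    have h4 : ∏ i, x (Sum.inr (C.col i)) = 0 := by
      by_contra h0
      refine hS.2 C (hC.trans fun e he => he.1)
        ((C.prod_colourWeight_eq_iff hlam hlam' hne).1 (mul_right_cancel₀ h0 h3).symm)
    obtain ⟨i, -, hi⟩ := Finset.prod_eq_zero_iff.1 h4
    refine hzero v _ (hC (Or.inl ⟨i, rfl⟩)).2 ?_
    change x (Sum.inl (C.row i)) = 0
    rw [h1, hi, mul_zero]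
  · rw [← Set.toFinset_card, ← Set.ncard_eq_toFinset_card', hcard]
    simp

end RowMatroid

/-- Lemma 3.3: for `λ ≠ λ'`, the maximal linearly independent sets of
rows of `SS_{λ,λ'}(B_max)` are exactly the edge sets of spanning independent cycle-rooted
forests in `K²_{m,n}`; in particular each such set has `m + n` elements. -/
theorem statement12 (m n : ℕ) (hm : 1 ≤ m) (hn : 1 ≤ n) (lam lam' : ℝ)
    (hlam : 0 < lam) (hlam' : 0 < lam') (hne : lam ≠ lam') (S : Set (Brace m n)) :
    ((RowsIndep m n lam lam' S ∧ ∀ S' : Set (Brace m n), S ⊂ S' → ¬RowsIndep m n lam lam' S') ↔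
        IsSpanningICRF m n S) ∧
      (IsSpanningICRF m n S → S.ncard = m + n) := by
  refine ⟨⟨fun ⟨hS, hmax⟩ => ?_, fun hS => ?_⟩, fun hS => ncard_eq_of_component_ncard_eq hS.1⟩
  · exact ⟨component_ncard_eq hS (ncard_eq_of_maximal_rowsIndep hm hn hne hS hmax),
      fun C => C.not_depColouring_of_rowsIndep hlam hlam' hne hS⟩
  · refine ⟨hS.rowsIndep hlam hlam' hne, fun S' hSS' hS' => ?_⟩
    have h1 := ncard_eq_of_component_ncard_eq hS.1
    have h2 := ncard_le_of_rowsIndep hS' Set.univ (by simp)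
    have h3 := Set.ncard_lt_ncard hSS'
    simp only [Set.ncard_univ, Nat.card_eq_fintype_card, Fintype.card_sum, Fintype.card_fin] at h2
    omega
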